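/- Let r ≥ 1, let ν, ν′ > r − 1 be real, and let S, S′ be symmetric positive definite r×r matrices. Then ∫ p_IW(D; ν′, S′) · log p_IW(D; ν, S) dD = −(ν′/2)·tr(S′^{−1} S) − (r(r−1)/4)·log π − ∑_{l=1}^r log Γ((ν + 1 − l)/2) + (ν/2)·log det S − ((ν + r + 1)/2)·[ log det S′ − ∑_{l=1}^r ψ((ν′ − l + 1)/2) − r·log 2 ] − (νr/2)·log 2, where the integral is over the cone of symmetric positive definite r×r matrices D with respect to Lebesgue measure on the r(r+1)/2 on-and-below-diagonal entries of D, and ψ = (log Γ)′ is the digamma function. -/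

import Mathlib

open MeasureTheory Matrix Real Finset

/-- The digamma function `ψ = (log Γ)′`. -/
noncomputable def digamma (x : ℝ) : ℝ := deriv (fun y => Real.log (Real.Gamma y)) x

/-- The multivariate gamma function `Γ_r(a) = π^{r(r-1)/4} ∏_{l=1}^r Γ(a + (1-l)/2)`. -/
noncomputable def multivariateGamma (r : ℕ) (a : ℝ) : ℝ :=
  Real.pi ^ ((r : ℝ) * ((r : ℝ) - 1) / 4) *
    ∏ l ∈ Finset.Icc 1 r, Real.Gamma (a + (1 - (l : ℝ)) / 2)

/-- The inverse Wishart density `p_IW(D; ν, S)` on the cone of symmetric positive definite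
`r×r` matrices (w.r.t. Lebesgue measure on the on-and-below-diagonal entries):
`det(S)^{ν/2} 2^{-νr/2} Γ_r(ν/2)⁻¹ det(D)^{-(ν+r+1)/2} exp(-(1/2) tr(S D⁻¹))`. -/
noncomputable def invWishartDensity (r : ℕ) (ν : ℝ) (S D : Matrix (Fin r) (Fin r) ℝ) : ℝ :=
  S.det ^ (ν / 2) * (2 : ℝ) ^ (-(ν * (r : ℝ)) / 2) / multivariateGamma r (ν / 2) *
    D.det ^ (-(ν + (r : ℝ) + 1) / 2) * Real.exp (-(1 / 2) * (S * D⁻¹).trace)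

/-- The symmetric matrix built from a vector of on-and-below-diagonal entries. -/
noncomputable def lowerToSym {r : ℕ} (v : {q : Fin r × Fin r // q.2 ≤ q.1} → ℝ) :
    Matrix (Fin r) (Fin r) ℝ :=
  Matrix.of fun k m => if h : m ≤ k then v ⟨(k, m), h⟩ else v ⟨(m, k), (not_le.mp h).le⟩

/-- Integral of a function `f` over the cone of symmetric positive definite `r×r` matrices,
with respect to Lebesgue measure on the `r(r+1)/2` on-and-below-diagonal entries. -/
noncomputable def spdIntegral (r : ℕ) (f : Matrix (Fin r) (Fin r) ℝ → ℝ) : ℝ :=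
  ∫ v : {q : Fin r × Fin r // q.2 ≤ q.1} → ℝ,
    Set.indicator {w : {q : Fin r × Fin r // q.2 ≤ q.1} → ℝ | (lowerToSym w).PosDef}
      (fun w => f (lowerToSym w)) v


section Blocks

variable {n : ℕ}

/-- The symmetric block matrix with blocks `A`, `b`, `bᵀ`, `d`. -/
noncomputable def borderedMatrix (A : Matrix (Fin n) (Fin n) ℝ) (b : Fin n → ℝ) (d : ℝ) :
    Matrix (Fin n ⊕ Fin 1) (Fin n ⊕ Fin 1) ℝ :=
  fromBlocks A (replicateCol (Fin 1) b) (replicateRow (Fin 1) b) (of fun _ _ => d)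

/-- The Schur complement of `A` in `borderedMatrix A b d`. -/
noncomputable def schurScalar (A : Matrix (Fin n) (Fin n) ℝ) (b : Fin n → ℝ) (d : ℝ) : ℝ :=
  d - b ⬝ᵥ (A⁻¹ *ᵥ b)

lemma schur_block (A : Matrix (Fin n) (Fin n) ℝ) (b : Fin n → ℝ) (d : ℝ) :
    (of fun _ _ => d) - replicateRow (Fin 1) b * A⁻¹ * replicateCol (Fin 1) b =
      of fun _ _ => schurScalar A b d := by
  ext i j
  rw [Matrix.mul_assoc]
  simp [schurScalar, Matrix.mul_apply, dotProduct, mulVec]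

lemma det_borderedMatrix {A : Matrix (Fin n) (Fin n) ℝ} (hA : A.PosDef) (b : Fin n → ℝ) (d : ℝ) :
    (borderedMatrix A b d).det = A.det * schurScalar A b d := by
  have := hA.isUnit.invertible
  rw [borderedMatrix, det_fromBlocks₁₁, invOf_eq_nonsing_inv, schur_block]
  simp

lemma posDef_borderedMatrix_iff {A : Matrix (Fin n) (Fin n) ℝ} {b : Fin n → ℝ} {d : ℝ} :
    (borderedMatrix A b d).PosDef ↔ A.PosDef ∧ 0 < schurScalar A b d := by
  have key (hA : A.PosDef) : (borderedMatrix A b d).PosSemidef ↔ 0 ≤ schurScalar A b d := by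
    have := hA.isUnit.invertible
    have h := PosDef.fromBlocks₁₁ (replicateCol (Fin 1) b) (of fun _ _ => d) hA
    have hB : (replicateCol (Fin 1) b)ᴴ = replicateRow (Fin 1) b := by ext; simp
    rw [hB, schur_block] at h
    rw [borderedMatrix, h]
    have : (of fun _ _ : Fin 1 => schurScalar A b d) = diagonal fun _ => schurScalar A b d := by
      ext i j; simp [Subsingleton.elim i j]
    rw [this, posSemidef_diagonal_iff]
    simp
  constructor
  · intro h
    have hA : A.PosDef := by
      have := h.submatrix (e := Sum.inl) Sum.inl_injective
      exact this
    refine ⟨hA, lt_of_le_of_ne ((key hA).1 h.posSemidef) ?_⟩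
    intro h0
    have := h.det_pos
    rw [det_borderedMatrix hA, ← h0] at this
    simp at this
  · rintro ⟨hA, hs⟩
    rw [((key hA).2 hs.le).posDef_iff_det_ne_zero, det_borderedMatrix hA]
    exact (mul_pos hA.det_pos hs).ne'

lemma borderedMatrix_mul_borderedMatrix (A B : Matrix (Fin n) (Fin n) ℝ) (b c : Fin n → ℝ)
    (d e : ℝ) :
    borderedMatrix A b d * borderedMatrix B c e =
      fromBlocks (A * B + vecMulVec b c) (replicateCol (Fin 1) (A *ᵥ c + e • b))
        (replicateRow (Fin 1) (b ᵥ* B + d • c)) (of fun _ _ => b ⬝ᵥ c + d * e) := by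
  rw [borderedMatrix, borderedMatrix, fromBlocks_multiply]
  congr 1 <;> ext i j <;>
    simp [Matrix.mul_apply, vecMulVec_apply, mulVec, vecMul, dotProduct, mul_comm]

lemma inv_borderedMatrix {A : Matrix (Fin n) (Fin n) ℝ} (hA : A.PosDef)
    (b : Fin n → ℝ) (d : ℝ) (hs : schurScalar A b d ≠ 0) :
    (borderedMatrix A b d)⁻¹ =
      borderedMatrix (A⁻¹ + (schurScalar A b d)⁻¹ • vecMulVec (A⁻¹ *ᵥ b) (A⁻¹ *ᵥ b))
        (-((schurScalar A b d)⁻¹ • (A⁻¹ *ᵥ b))) (schurScalar A b d)⁻¹ := by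
  set β := A⁻¹ *ᵥ b with hβ
  set s := schurScalar A b d with hsd
  have hAA : A * A⁻¹ = 1 := mul_nonsing_inv _ ((isUnit_iff_isUnit_det A).1 hA.isUnit)
  have hAβ : A *ᵥ β = b := by rw [hβ, mulVec_mulVec, hAA, one_mulVec]
  have hd : d = s + b ⬝ᵥ β := by rw [hsd, schurScalar, hβ]; ring
  have hbA : b ᵥ* A⁻¹ = β := by
    have : (A⁻¹)ᵀ = A⁻¹ := by simpa using hA.isHermitian.inv.eq
    rw [← mulVec_transpose, this]
  refine inv_eq_right_inv ?_
  rw [borderedMatrix_mul_borderedMatrix, ← fromBlocks_one]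
  congr 1
  · rw [Matrix.mul_add, hAA, Matrix.mul_smul, mul_vecMulVec, hAβ]
    ext i j
    simp [vecMulVec_apply]
  · rw [mulVec_neg, mulVec_smul, hAβ]
    ext; simp
  · rw [vecMul_add, hbA, vecMul_smul, vecMul_vecMulVec, hd]
    ext i j
    simp
    field_simp
    ring
  · ext i j
    rw [Subsingleton.elim i j, hd]
    simp
    field_simp
    ring

lemma trace_borderedMatrix_mul_inv {A : Matrix (Fin n) (Fin n) ℝ} (hA : A.PosDef)
    (b : Fin n → ℝ) (d : ℝ) (hs : schurScalar A b d ≠ 0)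
    (S : Matrix (Fin n) (Fin n) ℝ) (c : Fin n → ℝ) (e : ℝ) :
    (borderedMatrix S c e * (borderedMatrix A b d)⁻¹).trace =
      (S * A⁻¹).trace + (schurScalar A b d)⁻¹ *
        ((A⁻¹ *ᵥ b) ⬝ᵥ (S *ᵥ (A⁻¹ *ᵥ b)) - 2 * (c ⬝ᵥ (A⁻¹ *ᵥ b)) + e) := by
  have htr (A : Matrix (Fin n) (Fin n) ℝ) (B C) (D : Matrix (Fin 1) (Fin 1) ℝ) :
      (fromBlocks A B C D).trace = A.trace + D.trace := by
    simp [Matrix.trace]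
  rw [inv_borderedMatrix hA b d hs, borderedMatrix_mul_borderedMatrix, htr,
    Matrix.mul_add, Matrix.mul_smul, mul_vecMulVec, trace_add, trace_add, trace_smul,
    trace_vecMulVec, trace_vecMulVec, dotProduct_comm (S *ᵥ _)]
  simp [Matrix.trace]
  ring

lemma exists_submatrix_eq_borderedMatrix {S : Matrix (Fin (n + 1)) (Fin (n + 1)) ℝ}
    (hS : S.PosDef) :
    ∃ (T : Matrix (Fin n) (Fin n) ℝ) (c : Fin n → ℝ) (e : ℝ),
      S.submatrix finSumFinEquiv finSumFinEquiv = borderedMatrix T c e := by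
  refine ⟨S.submatrix Fin.castSucc Fin.castSucc, fun i => S i.castSucc (Fin.last n),
    S (Fin.last n) (Fin.last n), ?_⟩
  have hsymm (i j) : S i j = S j i := by simpa using (hS.isHermitian.apply i j).symm
  have hlast (i : Fin 1) : Fin.natAdd n i = Fin.last n := by ext; simp
  ext (i | i) (j | j)
  · rfl
  · simp [borderedMatrix, hlast]; rfl
  · simp [borderedMatrix, hlast]; exact hsymm _ _
  · simp [borderedMatrix, hlast]

end Blocks

section Integrals

variable {n : ℕ}

lemma lintegral_comp_mulVec {M : Matrix (Fin n) (Fin n) ℝ} (hM : M.det ≠ 0)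
    {f : (Fin n → ℝ) → ENNReal} (hf : Measurable f) :
    ∫⁻ x, f (M *ᵥ x) = ENNReal.ofReal |M.det⁻¹| * ∫⁻ x, f x := by
  have hmeas : Measurable (toLin' M) := (LinearMap.continuous_on_pi _).measurable
  have h := lintegral_map (μ := volume) hf hmeas
  rw [Real.map_matrix_volume_pi_eq_smul_volume_pi hM, lintegral_smul_measure] at h
  simpa using h.symm

lemma lintegral_exp_neg_mul_dotProduct_self {a : ℝ} (ha : 0 < a) :
    ∫⁻ x : Fin n → ℝ, ENNReal.ofReal (exp (-a * (x ⬝ᵥ x))) =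
      ENNReal.ofReal ((π / a) ^ ((n : ℝ) / 2)) := by
  have hprod (x : Fin n → ℝ) : exp (-a * (x ⬝ᵥ x)) = ∏ i, exp (-a * x i ^ 2) := by
    rw [← exp_sum, dotProduct, Finset.mul_sum]
    simp [pow_two]
  simp_rw [hprod]
  have hintegrable : Integrable (fun x : Fin n → ℝ => ∏ i, exp (-a * x i ^ 2)) :=
    Integrable.fintype_prod fun _ => integrable_exp_neg_mul_sq ha
  rw [← ofReal_integral_eq_lintegral_ofReal hintegrable
    (Filter.Eventually.of_forall fun x => Finset.prod_nonneg fun _ _ => (exp_pos _).le)]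
  rw [integral_fintype_prod_volume_eq_pow (fun y : ℝ => exp (-a * y ^ 2)), integral_gaussian,
    Real.sqrt_eq_rpow, ← rpow_natCast, ← rpow_mul (by positivity)]
  congr 2
  simp
  ring

lemma lintegral_exp_neg_mul_quadratic {T : Matrix (Fin n) (Fin n) ℝ} (hT : T.PosDef) {a : ℝ}
    (ha : 0 < a) :
    ∫⁻ x : Fin n → ℝ, ENNReal.ofReal (exp (-a * (x ⬝ᵥ (T *ᵥ x)))) =
      ENNReal.ofReal ((π / a) ^ ((n : ℝ) / 2) * T.det ^ (-(1 / 2) : ℝ)) := by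
  obtain ⟨B, rfl⟩ : ∃ B : Matrix (Fin n) (Fin n) ℝ, T = Bᵀ * B := by
    open scoped MatrixOrder in
    obtain ⟨B, hB⟩ := CStarAlgebra.nonneg_iff_eq_star_mul_self.mp hT.posSemidef.nonneg
    exact ⟨B, by simpa [star_eq_conjTranspose] using hB⟩
  have hdet : (Bᵀ * B).det = B.det ^ 2 := by rw [det_mul, det_transpose, pow_two]
  have hB : B.det ≠ 0 := fun h => by simpa [hdet, h] using hT.det_pos
  have hq (x : Fin n → ℝ) : x ⬝ᵥ ((Bᵀ * B) *ᵥ x) = (B *ᵥ x) ⬝ᵥ (B *ᵥ x) := by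
    rw [← mulVec_mulVec, dotProduct_mulVec, vecMul_transpose]
  simp_rw [hq]
  rw [lintegral_comp_mulVec hB (f := fun y => ENNReal.ofReal (exp (-a * (y ⬝ᵥ y))))
    (by unfold dotProduct; fun_prop), lintegral_exp_neg_mul_dotProduct_self ha,
    ← ENNReal.ofReal_mul (abs_nonneg _), hdet, mul_comm]
  congr 2
  rw [abs_inv, ← sq_abs, ← rpow_natCast, ← rpow_mul (abs_nonneg _)]
  norm_num [rpow_neg_one]

lemma lintegral_exp_neg_mul_quadratic_add {T : Matrix (Fin n) (Fin n) ℝ} (hT : T.PosDef)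
    (c : Fin n → ℝ) (e : ℝ) {a : ℝ} (ha : 0 < a) :
    ∫⁻ x : Fin n → ℝ, ENNReal.ofReal (exp (-a * (x ⬝ᵥ (T *ᵥ x) - 2 * (c ⬝ᵥ x) + e))) =
      ENNReal.ofReal ((π / a) ^ ((n : ℝ) / 2) * T.det ^ (-(1 / 2) : ℝ) *
        exp (-a * schurScalar T c e)) := by
  set x₀ := T⁻¹ *ᵥ c with hx₀
  have hTx₀ : T *ᵥ x₀ = c := by
    rw [hx₀, mulVec_mulVec, mul_nonsing_inv _ ((isUnit_iff_isUnit_det T).1 hT.isUnit), one_mulVec]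
  have hsymm (x y : Fin n → ℝ) : x ⬝ᵥ (T *ᵥ y) = y ⬝ᵥ (T *ᵥ x) := by
    have : Tᵀ = T := by simpa using hT.isHermitian.eq
    rw [dotProduct_mulVec, dotProduct_comm, ← mulVec_transpose, this]
  have hsq (x : Fin n → ℝ) : (x + x₀) ⬝ᵥ (T *ᵥ (x + x₀)) - 2 * (c ⬝ᵥ (x + x₀)) + e =
      x ⬝ᵥ (T *ᵥ x) + schurScalar T c e := by
    rw [mulVec_add, add_dotProduct, dotProduct_add, dotProduct_add, hsymm x₀ x, hTx₀,
      schurScalar, ← hx₀, dotProduct_add, dotProduct_comm x c, dotProduct_comm x₀ c]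
    ring
  rw [← lintegral_add_right_eq_self _ x₀]
  simp_rw [hsq, mul_add, exp_add, ENNReal.ofReal_mul (exp_pos _).le]
  rw [lintegral_mul_const _ (by unfold dotProduct mulVec dotProduct; fun_prop),
    lintegral_exp_neg_mul_quadratic hT ha,
    ← ENNReal.ofReal_mul (mul_nonneg (by positivity) (rpow_nonneg hT.det_pos.le _))]

lemma lintegral_rpow_mul_exp_neg_div {a b : ℝ} (ha : 0 < a) (hb : 0 < b) :
    ∫⁻ s in Set.Ioi (0 : ℝ), ENNReal.ofReal (s ^ (-a - 1) * exp (-b * s⁻¹)) =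
      ENNReal.ofReal (Gamma a * b ^ (-a)) := by
  have hintegrable : IntegrableOn (fun t : ℝ => t ^ (a - 1) * exp (-(b * t))) (Set.Ioi 0) := by
    by_contra h
    have := integral_undef h
    rw [integral_rpow_mul_exp_neg_mul_Ioi ha hb] at this
    have h2 : 0 < (1 / b) ^ a * Gamma a := mul_pos (by positivity) (Gamma_pos_of_pos ha)
    exact h2.ne' this
  have hcongr : Set.EqOn (fun x : ℝ => (|(-1 : ℝ)| * x ^ ((-1 : ℝ) - 1)) •
      ((x ^ (-1 : ℝ)) ^ (a - 1) * exp (-(b * x ^ (-1 : ℝ)))))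
      (fun s => s ^ (-a - 1) * exp (-b * s⁻¹)) (Set.Ioi 0) := by
    intro x hx
    have hx : (0 : ℝ) < x := hx
    simp only [smul_eq_mul]
    rw [← rpow_mul hx.le, ← mul_assoc, abs_neg, abs_one, one_mul, ← rpow_add hx, rpow_neg_one,
      neg_mul]
    congr 2 <;> ring
  have h1 := (integrableOn_Ioi_comp_rpow_iff _ (p := -1) (by norm_num)).2 hintegrable
  have h2 := integral_comp_rpow_Ioi (fun t : ℝ => t ^ (a - 1) * exp (-(b * t))) (p := -1)
    (by norm_num)
  rw [integral_rpow_mul_exp_neg_mul_Ioi ha hb, setIntegral_congr_fun measurableSet_Ioi hcongr]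
    at h2
  rw [integrableOn_congr_fun hcongr measurableSet_Ioi] at h1
  rw [← ofReal_integral_eq_lintegral_ofReal h1, h2, one_div, inv_rpow hb.le, rpow_neg hb.le,
    mul_comm]
  filter_upwards [ae_restrict_mem measurableSet_Ioi] with s hs
  exact mul_nonneg (rpow_nonneg (le_of_lt hs) _) (exp_pos _).le

lemma lintegral_schurScalar {A T : Matrix (Fin n) (Fin n) ℝ} (hA : A.PosDef) (hT : T.PosDef)
    (c : Fin n → ℝ) (e : ℝ) (hσ : 0 < schurScalar T c e) {ν : ℝ} (hν : 0 < ν) :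
    ∫⁻ b : Fin n → ℝ, ∫⁻ d : ℝ, (Set.Ioi (0 : ℝ)).indicator
        (fun s => ENNReal.ofReal (s ^ (-(ν + (n + 1 : ℕ) + 1) / 2) * exp (-(1 / 2) * (s⁻¹ *
          ((A⁻¹ *ᵥ b) ⬝ᵥ (T *ᵥ (A⁻¹ *ᵥ b)) - 2 * (c ⬝ᵥ (A⁻¹ *ᵥ b)) + e)))))
        (schurScalar A b d) =
      ENNReal.ofReal (A.det * ((2 * π) ^ ((n : ℝ) / 2) * T.det ^ (-(1 / 2) : ℝ) *
        (Gamma (ν / 2) * (schurScalar T c e / 2) ^ (-(ν / 2))))) := by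
  set q : (Fin n → ℝ) → ℝ := fun β => β ⬝ᵥ (T *ᵥ β) - 2 * (c ⬝ᵥ β) + e with hq
  have hqm : Measurable q := by
    rw [hq]; unfold mulVec dotProduct; fun_prop
  have hAm : Measurable fun b : Fin n → ℝ => A⁻¹ *ᵥ b := by
    unfold mulVec dotProduct; fun_prop
  have hdet : (A⁻¹).det ≠ 0 := hA.inv.det_pos.ne'
  have hstep (b : Fin n → ℝ) : ∫⁻ d : ℝ, (Set.Ioi (0 : ℝ)).indicator
      (fun s => ENNReal.ofReal (s ^ (-(ν + (n + 1 : ℕ) + 1) / 2) *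
        exp (-(1 / 2) * (s⁻¹ * q (A⁻¹ *ᵥ b))))) (schurScalar A b d) =
      ∫⁻ s in Set.Ioi (0 : ℝ), ENNReal.ofReal (s ^ (-(ν + (n + 1 : ℕ) + 1) / 2) *
        exp (-(1 / 2) * (s⁻¹ * q (A⁻¹ *ᵥ b)))) := by
    unfold schurScalar
    rw [lintegral_sub_right_eq_self, lintegral_indicator measurableSet_Ioi]
  change ∫⁻ b : Fin n → ℝ, ∫⁻ d : ℝ, (Set.Ioi (0 : ℝ)).indicator
      (fun s => ENNReal.ofReal (s ^ (-(ν + (n + 1 : ℕ) + 1) / 2) *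
        exp (-(1 / 2) * (s⁻¹ * q (A⁻¹ *ᵥ b))))) (schurScalar A b d) = _
  simp_rw [hstep]
  rw [lintegral_lintegral_swap (by
    have : Measurable fun p : (Fin n → ℝ) × ℝ => q (A⁻¹ *ᵥ p.1) :=
      hqm.comp (hAm.comp measurable_fst)
    apply Measurable.aemeasurable
    unfold Function.uncurry
    fun_prop)]
  have hinner : Set.EqOn (fun s : ℝ => ∫⁻ b : Fin n → ℝ,
      ENNReal.ofReal (s ^ (-(ν + (n + 1 : ℕ) + 1) / 2) *
        exp (-(1 / 2) * (s⁻¹ * q (A⁻¹ *ᵥ b)))))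
      (fun s => ENNReal.ofReal (A.det * ((2 * π) ^ ((n : ℝ) / 2) * T.det ^ (-(1 / 2) : ℝ))) *
        ENNReal.ofReal (s ^ (-(ν / 2) - 1) * exp (-(schurScalar T c e / 2) * s⁻¹)))
      (Set.Ioi 0) := by
    intro s hs
    have hs : (0 : ℝ) < s := hs
    have hT0 := hT.det_pos
    have hA0 := hA.det_pos
    have hassoc (β : Fin n → ℝ) : -(1 / 2) * (s⁻¹ * q β) = -(1 / 2 * s⁻¹) * q β := by ring
    simp_rw [hassoc, ENNReal.ofReal_mul (rpow_nonneg hs.le _)]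
    rw [lintegral_const_mul _ (by fun_prop),
      lintegral_comp_mulVec hdet (f := fun β => ENNReal.ofReal (exp (-(1 / 2 * s⁻¹) * q β)))
        (by fun_prop),
      lintegral_exp_neg_mul_quadratic_add hT c e (by positivity),
      ← ENNReal.ofReal_mul (by positivity), ← ENNReal.ofReal_mul (by positivity),
      ← ENNReal.ofReal_mul (by positivity), ← ENNReal.ofReal_mul (by positivity)]
    congr 1
    have h1 : |((A⁻¹).det)⁻¹| = A.det := by
      rw [det_nonsing_inv, Ring.inverse_eq_inv', inv_inv, abs_of_pos hA0]
    have h2 : π / (1 / 2 * s⁻¹) = 2 * π * s := by field_simp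
    have h3 : s ^ (-(ν / 2) - 1) = s ^ (-(ν + (n + 1 : ℕ) + 1) / 2) * s ^ ((n : ℝ) / 2) := by
      rw [← rpow_add hs]; congr 1; push_cast; ring
    rw [h1, h2, h3, mul_rpow (by positivity) hs.le,
      show -(1 / 2 * s⁻¹) * schurScalar T c e = -(schurScalar T c e / 2) * s⁻¹ by ring]
    ring
  rw [setLIntegral_congr_fun measurableSet_Ioi hinner, lintegral_const_mul _ (by fun_prop),
    lintegral_rpow_mul_exp_neg_div (by positivity) (by positivity),
    ← ENNReal.ofReal_mul (by have := hT.det_pos; have := hA.det_pos; positivity)]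
  congr 1
  ring

end Integrals

section Coordinates

/-- The index set of the on-and-below-diagonal entries. -/
abbrev LowerIndex (n : ℕ) := {q : Fin n × Fin n // q.2 ≤ q.1}

variable {n : ℕ}

/-- Splitting the on-and-below-diagonal positions into those of the leading principal block, the
rest of the last row, and the last diagonal entry. -/
def lowerIndexOfSum : LowerIndex n ⊕ (Fin n ⊕ Fin 1) → LowerIndex (n + 1)
  | Sum.inl q => ⟨(q.1.1.castSucc, q.1.2.castSucc), q.2⟩
  | Sum.inr (Sum.inl j) => ⟨(Fin.last n, j.castSucc), Fin.le_last _⟩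
  | Sum.inr (Sum.inr _) => ⟨(Fin.last n, Fin.last n), le_rfl⟩

lemma lowerIndexOfSum_bijective : Function.Bijective (lowerIndexOfSum (n := n)) := by
  constructor
  · rintro (⟨⟨i, j⟩, hij⟩ | j | k) (⟨⟨i', j'⟩, hij'⟩ | j' | k') h <;>
      simp [lowerIndexOfSum, Fin.ext_iff] at h ⊢ <;> omega
  · rintro ⟨⟨i, j⟩, hij⟩
    induction i using Fin.lastCases with
    | last =>
      induction j using Fin.lastCases with
      | last => exact ⟨Sum.inr (Sum.inr 0), rfl⟩
      | cast j => exact ⟨Sum.inr (Sum.inl j), rfl⟩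
    | cast i =>
      induction j using Fin.lastCases with
      | last => exact absurd hij (by simp [Fin.le_def])
      | cast j => exact ⟨Sum.inl ⟨(i, j), hij⟩, rfl⟩

lemma exists_measurePreserving_borderedMatrix :
    ∃ Φ : (LowerIndex n → ℝ) × ((Fin n → ℝ) × ℝ) → (LowerIndex (n + 1) → ℝ),
      MeasurePreserving Φ volume volume ∧ ∀ p,
        (lowerToSym (Φ p)).submatrix finSumFinEquiv finSumFinEquiv =
          borderedMatrix (lowerToSym p.1) p.2.1 p.2.2 := by
  let ε : LowerIndex n ⊕ (Fin n ⊕ Fin 1) ≃ LowerIndex (n + 1) :=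
    Equiv.ofBijective _ lowerIndexOfSum_bijective
  have h₁ := volume_measurePreserving_piCongrLeft (fun _ : LowerIndex (n + 1) => ℝ) ε
  have h₂ := volume_measurePreserving_sumPiEquivProdPi_symm
    (fun _ : LowerIndex n ⊕ (Fin n ⊕ Fin 1) => ℝ)
  have h₃ := volume_measurePreserving_sumPiEquivProdPi_symm (fun _ : Fin n ⊕ Fin 1 => ℝ)
  have h₄ := (volume_preserving_funUnique (Fin 1) ℝ).symm
  have h₅ := (MeasurePreserving.id (volume : Measure (LowerIndex n → ℝ))).prod
    (h₃.comp ((MeasurePreserving.id (volume : Measure (Fin n → ℝ))).prod h₄))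
  refine ⟨_, (h₁.comp h₂).comp h₅, ?_⟩
  rintro ⟨v, b, d⟩
  set w := ((MeasurableEquiv.piCongrLeft (fun _ : LowerIndex (n + 1) => ℝ) ε) ∘
    (MeasurableEquiv.sumPiEquivProdPi
      (fun _ : LowerIndex n ⊕ (Fin n ⊕ Fin 1) => ℝ)).symm)
    (Prod.map id ((MeasurableEquiv.sumPiEquivProdPi (fun _ : Fin n ⊕ Fin 1 => ℝ)).symm ∘
      Prod.map id (MeasurableEquiv.funUnique (Fin 1) ℝ).symm) (v, b, d)) with hw
  have hval (i) : w (ε i) = Sum.elim v (Sum.elim b fun _ => d) i := by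
    rw [hw]
    simp only [Function.comp_apply, MeasurableEquiv.coe_piCongrLeft,
      Equiv.piCongrLeft_apply_apply]
    rcases i with i | i | i <;> rfl
  have hlast (i : Fin 1) : Fin.natAdd n i = Fin.last n := by ext; simp
  change (lowerToSym w).submatrix _ _ = _
  have hcast (i : Fin n) : Fin.castAdd 1 i = i.castSucc := rfl
  ext (i | i) (j | j)
  · simp only [lowerToSym, submatrix_apply, finSumFinEquiv_apply_left, hcast, of_apply,
      borderedMatrix, fromBlocks_apply₁₁]
    by_cases h : j ≤ i
    · rw [dif_pos h, dif_pos (by simpa using h)]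
      exact hval (Sum.inl ⟨(i, j), h⟩)
    · rw [dif_neg h, dif_neg (by simpa using h)]
      exact hval (Sum.inl ⟨(j, i), (not_le.mp h).le⟩)
  · simp only [lowerToSym, submatrix_apply, finSumFinEquiv_apply_left, finSumFinEquiv_apply_right,
      hcast, hlast, of_apply, borderedMatrix, fromBlocks_apply₁₂, replicateCol_apply]
    rw [dif_neg (by simp [Fin.le_def])]
    exact hval (Sum.inr (Sum.inl i))
  · simp only [lowerToSym, submatrix_apply, finSumFinEquiv_apply_left, finSumFinEquiv_apply_right,
      hcast, hlast, of_apply, borderedMatrix, fromBlocks_apply₂₁, replicateRow_apply]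
    rw [dif_pos (Fin.le_last _)]
    exact hval (Sum.inr (Sum.inl j))
  · simp only [lowerToSym, submatrix_apply, finSumFinEquiv_apply_right,
      hlast, of_apply, borderedMatrix, fromBlocks_apply₂₂]
    rw [dif_pos le_rfl]
    exact hval (Sum.inr (Sum.inr 0))

lemma continuous_lowerToSym : Continuous (lowerToSym (r := n)) := by
  refine continuous_matrix fun i j => ?_
  simp only [lowerToSym, of_apply]
  split_ifs <;> fun_prop

lemma measurableSet_posDef_lowerToSym :
    MeasurableSet {w : LowerIndex n → ℝ | (lowerToSym w).PosDef} := by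
  have hset : {w : LowerIndex n → ℝ | (lowerToSym w).PosDef} =
      (⋂ x : Fin n → ℝ, {w | 0 ≤ x ⬝ᵥ (lowerToSym w *ᵥ x)}) ∩ {w | (lowerToSym w).det ≠ 0} := by
    ext w
    simp only [Set.mem_ofPred_eq, Set.mem_inter_iff, Set.mem_iInter]
    constructor
    · intro h
      exact ⟨fun x => by simpa using h.posSemidef.dotProduct_mulVec_nonneg x, h.det_pos.ne'⟩
    · rintro ⟨h, hdet⟩
      have hsymm : (lowerToSym w).IsHermitian := by
        ext i j
        simp only [conjTranspose_apply, star_trivial, lowerToSym, of_apply]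
        rcases lt_trichotomy i j with hij | rfl | hij
        · simp [hij.le, hij.not_ge]
        · rfl
        · simp [hij.le, hij.not_ge]
      exact (PosSemidef.of_dotProduct_mulVec_nonneg hsymm
        (by simpa using h)).posDef_iff_det_ne_zero.2 hdet
  have hc := continuous_lowerToSym (n := n)
  rw [hset]
  refine MeasurableSet.inter (IsClosed.measurableSet (isClosed_iInter fun x =>
    isClosed_le continuous_const ?_)) (isOpen_ne_fun ?_ continuous_const).measurableSet
  · fun_prop
  · exact hc.matrix_det

end Coordinates

section Normalization

variable {n : ℕ}

/-- The unnormalized inverse Wishart density. -/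
noncomputable def invWishartKernel (n : ℕ) (ν : ℝ) (S D : Matrix (Fin n) (Fin n) ℝ) : ℝ :=
  D.det ^ (-(ν + (n : ℝ) + 1) / 2) * exp (-(1 / 2) * (S * D⁻¹).trace)

/-- The total mass of `invWishartKernel`. -/
noncomputable def invWishartMass (n : ℕ) (ν : ℝ) (S : Matrix (Fin n) (Fin n) ℝ) : ℝ :=
  (2 : ℝ) ^ (ν * n / 2) * multivariateGamma n (ν / 2) * S.det ^ (-(ν / 2))

lemma measurable_invWishartKernel (ν : ℝ) (S : Matrix (Fin n) (Fin n) ℝ) :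
    Measurable fun w : LowerIndex n → ℝ => invWishartKernel n ν S (lowerToSym w) := by
  have hc := continuous_lowerToSym (n := n)
  have hdet : Measurable fun w : LowerIndex n → ℝ => (lowerToSym w).det := hc.matrix_det.measurable
  have htr : Measurable fun w : LowerIndex n → ℝ => (S * (lowerToSym w)⁻¹).trace := by
    simp_rw [Matrix.inv_def, Matrix.mul_smul, trace_smul, Ring.inverse_eq_inv', smul_eq_mul]
    exact hdet.inv.mul (continuous_const.matrix_mul hc.matrix_adjugate).matrix_trace.measurable
  unfold invWishartKernel
  fun_prop

lemma invWishartKernel_pos (ν : ℝ) (S : Matrix (Fin n) (Fin n) ℝ) {D : Matrix (Fin n) (Fin n) ℝ}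
    (hD : D.PosDef) : 0 < invWishartKernel n ν S D :=
  mul_pos (rpow_pos_of_pos hD.det_pos _) (exp_pos _)

lemma multivariateGamma_pos {a : ℝ} (ha : ((n : ℝ) - 1) / 2 < a) : 0 < multivariateGamma n a := by
  refine mul_pos (rpow_pos_of_pos pi_pos _) (Finset.prod_pos fun l hl => Gamma_pos_of_pos ?_)
  have : (l : ℝ) ≤ n := by exact_mod_cast (Finset.mem_Icc.1 hl).2
  linarith

lemma invWishartMass_pos {ν : ℝ} (hν : (n : ℝ) - 1 < ν) {S : Matrix (Fin n) (Fin n) ℝ}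
    (hS : S.PosDef) : 0 < invWishartMass n ν S :=
  mul_pos (mul_pos (by positivity) (multivariateGamma_pos (by linarith)))
    (rpow_pos_of_pos hS.det_pos _)

lemma multivariateGamma_succ (n : ℕ) (a : ℝ) :
    multivariateGamma (n + 1) a =
      π ^ ((n : ℝ) / 2) * Gamma a * multivariateGamma n (a - 1 / 2) := by
  have hprod : ∏ l ∈ Finset.Icc 1 (n + 1), Gamma (a + (1 - (l : ℝ)) / 2) =
      Gamma a * ∏ l ∈ Finset.Icc 1 n, Gamma (a - 1 / 2 + (1 - (l : ℝ)) / 2) := by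
    rw [← Finset.Ico_add_one_right_eq_Icc, ← Finset.Ico_add_one_right_eq_Icc,
      Finset.prod_Ico_eq_prod_range, Finset.prod_Ico_eq_prod_range]
    simp only [Nat.add_sub_cancel]
    rw [Finset.prod_range_succ', mul_comm]
    congr 1
    · simp
    · refine Finset.prod_congr rfl fun k _ => ?_
      congr 1
      push_cast
      ring
  unfold multivariateGamma
  rw [hprod, show ((n + 1 : ℕ) : ℝ) * (((n + 1 : ℕ) : ℝ) - 1) / 4 =
    (n : ℝ) / 2 + n * ((n : ℝ) - 1) / 4 by push_cast; ring, rpow_add pi_pos]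
  ring

lemma invWishartMass_succ {ν : ℝ} {S : Matrix (Fin (n + 1)) (Fin (n + 1)) ℝ}
    {T : Matrix (Fin n) (Fin n) ℝ} {c : Fin n → ℝ} {e : ℝ} (hT : T.PosDef)
    (hσ : 0 < schurScalar T c e) (hdet : S.det = T.det * schurScalar T c e) :
    invWishartMass (n + 1) ν S =
      (2 * π) ^ ((n : ℝ) / 2) * T.det ^ (-(1 / 2) : ℝ) *
        (Gamma (ν / 2) * (schurScalar T c e / 2) ^ (-(ν / 2))) * invWishartMass n (ν - 1) T := by
  have hT0 := hT.det_pos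
  unfold invWishartMass
  rw [multivariateGamma_succ, hdet, mul_rpow hT0.le hσ.le, div_rpow hσ.le (by norm_num),
    mul_rpow (by norm_num) pi_pos.le, rpow_neg (x := 2) (by norm_num), div_inv_eq_mul,
    show (ν - 1) / 2 = ν / 2 - 1 / 2 by ring,
    show -(ν / 2) = -(1 / 2) + -(ν / 2 - 1 / 2) by ring, rpow_add hT0,
    show ν * ((n + 1 : ℕ) : ℝ) / 2 = (n : ℝ) / 2 + ν / 2 + (ν - 1) * n / 2 by push_cast; ring,
    rpow_add (by norm_num), rpow_add (by norm_num)]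
  ring

/-- In block coordinates `(A, b, d)`, the inverse Wishart kernel factors through `A` and the Schur
complement of `A`. -/
lemma invWishartKernel_of_borderedMatrix {ν : ℝ} {S D : Matrix (Fin (n + 1)) (Fin (n + 1)) ℝ}
    {T A : Matrix (Fin n) (Fin n) ℝ} {c b : Fin n → ℝ} {e d : ℝ}
    (hS : S.submatrix finSumFinEquiv finSumFinEquiv = borderedMatrix T c e)
    (hD : D.submatrix finSumFinEquiv finSumFinEquiv = borderedMatrix A b d)
    (hA : A.PosDef) (hs : 0 < schurScalar A b d) :
    invWishartKernel (n + 1) ν S D =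
      A.det ^ (-(ν + (n + 1 : ℕ) + 1) / 2) * exp (-(1 / 2) * (T * A⁻¹).trace) *
        ((schurScalar A b d) ^ (-(ν + (n + 1 : ℕ) + 1) / 2) *
          exp (-(1 / 2) * ((schurScalar A b d)⁻¹ *
            ((A⁻¹ *ᵥ b) ⬝ᵥ (T *ᵥ (A⁻¹ *ᵥ b)) - 2 * (c ⬝ᵥ (A⁻¹ *ᵥ b)) + e)))) := by
  have hdet : D.det = A.det * schurScalar A b d := by
    rw [← det_borderedMatrix hA, ← hD, det_submatrix_equiv_self]
  have htr : (S * D⁻¹).trace = (borderedMatrix T c e * (borderedMatrix A b d)⁻¹).trace := by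
    rw [← hS, ← hD, inv_submatrix_equiv, submatrix_mul_equiv]
    exact (Equiv.sum_comp finSumFinEquiv fun i => (S * D⁻¹) i i).symm
  rw [invWishartKernel, hdet, htr, trace_borderedMatrix_mul_inv hA b d hs.ne',
    mul_rpow hA.det_pos.le hs.le, mul_add, exp_add]
  ring

theorem lintegral_invWishartKernel (n : ℕ) {ν : ℝ} (hν : (n : ℝ) - 1 < ν)
    {S : Matrix (Fin n) (Fin n) ℝ} (hS : S.PosDef) :
    ∫⁻ w in {w : LowerIndex n → ℝ | (lowerToSym w).PosDef},
      ENNReal.ofReal (invWishartKernel n ν S (lowerToSym w)) =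
        ENNReal.ofReal (invWishartMass n ν S) := by
  induction n generalizing ν with
  | zero =>
    have hset : {w : LowerIndex 0 → ℝ | (lowerToSym w).PosDef} = Set.univ := by
      ext w
      have : lowerToSym w = 1 := Subsingleton.elim _ _
      simp [this, PosDef.one]
    have h1 (w : LowerIndex 0 → ℝ) : invWishartKernel 0 ν S (lowerToSym w) = 1 := by
      simp [invWishartKernel]
    simp [hset, h1, invWishartMass, multivariateGamma, volume_pi]
  | succ n ih =>
    obtain ⟨T, c, e, hSb⟩ := exists_submatrix_eq_borderedMatrix hS
    have hSb' : (borderedMatrix T c e).PosDef := hSb ▸ hS.submatrix finSumFinEquiv.injective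
    obtain ⟨hT, hσ⟩ := posDef_borderedMatrix_iff.1 hSb'
    have hdetS : S.det = T.det * schurScalar T c e := by
      rw [← det_borderedMatrix hT, ← hSb, det_submatrix_equiv_self]
    push_cast at hν
    have hν0 : 0 < ν := by have : (0 : ℝ) ≤ n := n.cast_nonneg; linarith
    obtain ⟨Φ, hΦ, hΦb⟩ := exists_measurePreserving_borderedMatrix (n := n)
    have hpd (p) : (lowerToSym (Φ p)).PosDef ↔
        (lowerToSym p.1).PosDef ∧ 0 < schurScalar (lowerToSym p.1) p.2.1 p.2.2 := by
      rw [← posDef_borderedMatrix_iff, ← hΦb]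
      refine ⟨fun h => h.submatrix finSumFinEquiv.injective, fun h => ?_⟩
      simpa using h.submatrix finSumFinEquiv.symm.injective
    have hmeas : Measurable ({w : LowerIndex (n + 1) → ℝ | (lowerToSym w).PosDef}.indicator
        fun w => ENNReal.ofReal (invWishartKernel (n + 1) ν S (lowerToSym w))) :=
      (measurable_invWishartKernel ν S).ennreal_ofReal.indicator measurableSet_posDef_lowerToSym
    set κ : ℝ := (2 * π) ^ ((n : ℝ) / 2) * T.det ^ (-(1 / 2) : ℝ) *
      (Gamma (ν / 2) * (schurScalar T c e / 2) ^ (-(ν / 2))) with hκ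
    have hκ0 : 0 ≤ κ := by
      have := hT.det_pos
      have := Gamma_pos_of_pos (half_pos hν0)
      positivity
    rw [← lintegral_indicator measurableSet_posDef_lowerToSym, ← hΦ.lintegral_comp hmeas,
      Measure.volume_eq_prod, lintegral_prod _ (by exact (hmeas.comp hΦ.measurable).aemeasurable)]
    have hinner (v : LowerIndex n → ℝ) :
        ∫⁻ y : (Fin n → ℝ) × ℝ, {w : LowerIndex (n + 1) → ℝ | (lowerToSym w).PosDef}.indicator
          (fun w => ENNReal.ofReal (invWishartKernel (n + 1) ν S (lowerToSym w))) (Φ (v, y)) =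
        {w : LowerIndex n → ℝ | (lowerToSym w).PosDef}.indicator (fun w => ENNReal.ofReal κ *
          ENNReal.ofReal (invWishartKernel n (ν - 1) T (lowerToSym w))) v := by
      by_cases hv : (lowerToSym v).PosDef
      · set A := lowerToSym v with hA
        have hA0 := hv.det_pos
        rw [Set.indicator_of_mem (by exact hv), Measure.volume_eq_prod,
          lintegral_prod _ (by
            exact (hmeas.comp (hΦ.measurable.comp measurable_prodMk_left)).aemeasurable)]
        have hpt (b : Fin n → ℝ) (d : ℝ) :
            {w : LowerIndex (n + 1) → ℝ | (lowerToSym w).PosDef}.indicator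
              (fun w => ENNReal.ofReal (invWishartKernel (n + 1) ν S (lowerToSym w)))
              (Φ (v, b, d)) =
            ENNReal.ofReal (A.det ^ (-(ν + (n + 1 : ℕ) + 1) / 2) *
              exp (-(1 / 2) * (T * A⁻¹).trace)) *
            (Set.Ioi (0 : ℝ)).indicator
              (fun s => ENNReal.ofReal (s ^ (-(ν + (n + 1 : ℕ) + 1) / 2) * exp (-(1 / 2) * (s⁻¹ *
                ((A⁻¹ *ᵥ b) ⬝ᵥ (T *ᵥ (A⁻¹ *ᵥ b)) - 2 * (c ⬝ᵥ (A⁻¹ *ᵥ b)) + e)))))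
              (schurScalar A b d) := by
          by_cases hs : 0 < schurScalar A b d
          · rw [Set.indicator_of_mem (by exact (hpd _).2 ⟨hv, hs⟩), Set.indicator_of_mem (by exact hs),
              ← ENNReal.ofReal_mul (by positivity),
              invWishartKernel_of_borderedMatrix hSb (hΦb _) hv hs]
          · rw [Set.indicator_of_notMem (by exact fun h => hs ((hpd _).1 h).2),
              Set.indicator_of_notMem (by exact hs), mul_zero]
        simp_rw [hpt, lintegral_const_mul' _ _ ENNReal.ofReal_ne_top]
        rw [lintegral_schurScalar hv hT c e hσ hν0, ← ENNReal.ofReal_mul (by positivity),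
          ← ENNReal.ofReal_mul hκ0, ← hκ, invWishartKernel,
          show -(ν - 1 + (n : ℝ) + 1) / 2 = -(ν + (n + 1 : ℕ) + 1) / 2 + 1 by push_cast; ring,
          rpow_add_one hA0.ne']
        congr 1
        ring
      · rw [Set.indicator_of_notMem (by exact hv)]
        refine lintegral_eq_zero_of_ae_eq_zero (Filter.Eventually.of_forall fun y => ?_)
        exact Set.indicator_of_notMem (by exact fun h => hv ((hpd (v, y)).1 h).1) _
    simp_rw [hinner]
    rw [lintegral_indicator measurableSet_posDef_lowerToSym,
      lintegral_const_mul' _ _ ENNReal.ofReal_ne_top, ih (by linarith) hT,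
      ← ENNReal.ofReal_mul hκ0, invWishartMass_succ hT hσ hdetS]

end Normalization

section CrossEntropy

open Filter Topology ProbabilityTheory

variable {n : ℕ} {ν ν' : ℝ} {S S' : Matrix (Fin n) (Fin n) ℝ}

lemma integrable_invWishartKernel (hν : (n : ℝ) - 1 < ν) (hS : S.PosDef) :
    IntegrableOn (fun w : LowerIndex n → ℝ => invWishartKernel n ν S (lowerToSym w))
      {w | (lowerToSym w).PosDef} := by
  refine (lintegral_ofReal_ne_top_iff_integrable
    (measurable_invWishartKernel ν S).aestronglyMeasurable ?_).1 ?_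
  · filter_upwards [ae_restrict_mem measurableSet_posDef_lowerToSym] with w hw
    exact (invWishartKernel_pos ν S hw).le
  · rw [lintegral_invWishartKernel n hν hS]
    exact ENNReal.ofReal_ne_top

lemma integral_invWishartKernel (hν : (n : ℝ) - 1 < ν) (hS : S.PosDef) :
    ∫ w in {w : LowerIndex n → ℝ | (lowerToSym w).PosDef}, invWishartKernel n ν S (lowerToSym w) =
      invWishartMass n ν S := by
  rw [integral_eq_lintegral_of_nonneg_ae _
    (measurable_invWishartKernel ν S).aestronglyMeasurable, lintegral_invWishartKernel n hν hS,
    ENNReal.toReal_ofReal (invWishartMass_pos hν hS).le]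
  filter_upwards [ae_restrict_mem measurableSet_posDef_lowerToSym] with w hw
  exact (invWishartKernel_pos ν S hw).le

lemma invWishartDensity_eq_kernel (hS : S.PosDef) (D : Matrix (Fin n) (Fin n) ℝ) :
    invWishartDensity n ν S D = (invWishartMass n ν S)⁻¹ * invWishartKernel n ν S D := by
  rw [invWishartDensity, invWishartMass, invWishartKernel, rpow_neg hS.det_pos.le, neg_div,
    rpow_neg zero_le_two, mul_inv, mul_inv, inv_inv]
  ring

/-- Exponential tilting maps the inverse Wishart family to itself. -/
lemma invWishartKernel_mul_exp_log_density (hν : (n : ℝ) - 1 < ν) (hS : S.PosDef) (t : ℝ)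
    {D : Matrix (Fin n) (Fin n) ℝ} (hD : D.PosDef) :
    invWishartKernel n ν' S' D * exp (t * log (invWishartDensity n ν S D)) =
      exp (-(t * log (invWishartMass n ν S))) *
        invWishartKernel n (ν' + t * (ν + n + 1)) (S' + t • S) D := by
  have hM := invWishartMass_pos hν hS
  have hd := hD.det_pos
  rw [invWishartDensity_eq_kernel hS,
    log_mul (inv_ne_zero hM.ne') (invWishartKernel_pos ν S hD).ne', log_inv]
  simp only [invWishartKernel]
  rw [log_mul (rpow_pos_of_pos hd _).ne' (exp_pos _).ne', log_exp, log_rpow hd,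
    rpow_def_of_pos hd, rpow_def_of_pos hd, ← exp_add, ← exp_add, ← exp_add, ← exp_add, add_mul,
    trace_add, Matrix.smul_mul, trace_smul, smul_eq_mul]
  congr 1
  ring

lemma eventually_posDef_add_smul (hS' : S'.PosDef) (hS : S.IsHermitian) :
    ∀ᶠ t : ℝ in 𝓝 0, (S' + t • S).PosDef := by
  have hK := isCompact_sphere (0 : Fin n → ℝ) 1
  have hev : ∀ᶠ t : ℝ in 𝓝 0, ∀ x ∈ Metric.sphere (0 : Fin n → ℝ) 1,
      0 < x ⬝ᵥ ((S' + t • S) *ᵥ x) := by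
    refine hK.eventually_forall_of_forall_eventually fun x hx => ?_
    have hc : Continuous fun p : ℝ × (Fin n → ℝ) => p.2 ⬝ᵥ ((S' + p.1 • S) *ᵥ p.2) := by
      fun_prop
    refine hc.continuousAt.eventually_const_lt ?_
    have hx0 : x ≠ 0 := by
      rintro rfl
      simp at hx
    simpa using hS'.dotProduct_mulVec_pos hx0
  filter_upwards [hev] with t ht
  refine PosDef.of_dotProduct_mulVec_pos
    (hS'.isHermitian.add (hS.smul (IsSelfAdjoint.all t))) fun {x} hx => ?_
  have hn : 0 < ‖x‖ := norm_pos_iff.2 hx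
  have h := ht (‖x‖⁻¹ • x) (by simp [norm_smul, hn.ne'])
  rw [mulVec_smul, smul_dotProduct, dotProduct_smul, smul_eq_mul, smul_eq_mul] at h
  have h2 := pos_of_mul_pos_right h (by positivity)
  simpa using pos_of_mul_pos_right h2 (by positivity)

lemma hasDerivAt_log_det_add_smul (hS' : S'.PosDef) :
    HasDerivAt (fun t : ℝ => log (S' + t • S).det) (S'⁻¹ * S).trace 0 := by
  have hu : IsUnit S'.det := hS'.det_pos.ne'.isUnit
  have hfac (t : ℝ) : (S' + t • S).det = S'.det * (1 + t • (S'⁻¹ * S)).det := by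
    rw [← det_mul, mul_add, mul_one, Matrix.mul_smul, mul_nonsing_inv_cancel_left _ _ hu]
  have hpoly (M : Matrix (Fin n) (Fin n) ℝ) (t : ℝ) : (1 + t • M).det =
      (det (1 + (Polynomial.X : Polynomial ℝ) • M.map Polynomial.C)).eval t := by
    rw [← Polynomial.coe_evalRingHom, RingHom.map_det]
    congr 1
    ext i j
    simp [Matrix.one_apply, apply_ite, mul_comm t]
  have hd : HasDerivAt (fun t : ℝ => (S' + t • S).det) (S'.det * (S'⁻¹ * S).trace) 0 := by
    simp_rw [hfac, hpoly]
    rw [← derivative_det_one_add_X_smul]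
    exact (Polynomial.hasDerivAt _ _).const_mul _
  have := hd.log (by simpa using hS'.det_pos.ne')
  simpa [hS'.det_pos.ne'] using this

lemma hasDerivAt_log_Gamma {x : ℝ} (hx : 0 < x) :
    HasDerivAt (fun y => log (Gamma y)) (digamma x) x := by
  refine DifferentiableAt.hasDerivAt (DifferentiableAt.log (differentiableAt_Gamma fun m => ?_)
    (Gamma_pos_of_pos hx).ne')
  have : (0 : ℝ) ≤ m := m.cast_nonneg
  linarith

lemma log_invWishartMass (hν : (n : ℝ) - 1 < ν) (hS : S.PosDef) :
    log (invWishartMass n ν S) = ν * n / 2 * log 2 + (n : ℝ) * ((n : ℝ) - 1) / 4 * log π +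
      ∑ l ∈ Finset.Icc 1 n, log (Gamma ((ν + 1 - (l : ℝ)) / 2)) - ν / 2 * log S.det := by
  have hG (l) (hl : l ∈ Finset.Icc 1 n) : Gamma (ν / 2 + (1 - (l : ℝ)) / 2) ≠ 0 := by
    have : (l : ℝ) ≤ n := by exact_mod_cast (Finset.mem_Icc.1 hl).2
    exact (Gamma_pos_of_pos (by linarith)).ne'
  rw [invWishartMass, log_mul (mul_pos (by positivity) (multivariateGamma_pos (by linarith))).ne'
      (rpow_pos_of_pos hS.det_pos _).ne',
    log_mul (by positivity) (multivariateGamma_pos (by linarith)).ne', multivariateGamma,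
    log_mul (by positivity) (Finset.prod_ne_zero_iff.2 hG), log_prod hG, log_rpow two_pos,
    log_rpow pi_pos, log_rpow hS.det_pos]
  simp_rw [show ∀ l : ℝ, ν / 2 + (1 - l) / 2 = (ν + 1 - l) / 2 from fun l => by ring]
  ring

lemma hasDerivAt_log_invWishartMass (hν' : (n : ℝ) - 1 < ν') (hS' : S'.PosDef)
    (hS : S.IsHermitian) (k : ℝ) :
    HasDerivAt (fun t : ℝ => log (invWishartMass n (ν' + t * k) (S' + t • S)))
      (k * n / 2 * log 2 + ∑ l ∈ Finset.Icc 1 n, k / 2 * digamma ((ν' - (l : ℝ) + 1) / 2) -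
        (k / 2 * log S'.det + ν' / 2 * (S'⁻¹ * S).trace)) 0 := by
  have hlin : HasDerivAt (fun t : ℝ => ν' + t * k) k 0 := by
    simpa using ((hasDerivAt_id (0 : ℝ)).mul_const k).const_add ν'
  have hν_ev : ∀ᶠ t : ℝ in 𝓝 0, (n : ℝ) - 1 < ν' + t * k :=
    hlin.continuousAt.eventually_const_lt (by simpa using hν')
  have hsum : HasDerivAt
      (fun t : ℝ => ∑ l ∈ Finset.Icc 1 n, log (Gamma ((ν' + t * k + 1 - (l : ℝ)) / 2)))
      (∑ l ∈ Finset.Icc 1 n, k / 2 * digamma ((ν' - (l : ℝ) + 1) / 2)) 0 := by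
    refine HasDerivAt.fun_sum fun l hl => ?_
    have hl' : (l : ℝ) ≤ n := by exact_mod_cast (Finset.mem_Icc.1 hl).2
    have harg : (ν' + 0 * k + 1 - (l : ℝ)) / 2 = (ν' - (l : ℝ) + 1) / 2 := by ring
    have hin : HasDerivAt (fun t : ℝ => (ν' + t * k + 1 - (l : ℝ)) / 2) (k / 2) 0 :=
      ((hlin.add_const 1).sub_const (l : ℝ)).div_const 2
    have hG := hasDerivAt_log_Gamma (x := (ν' + 0 * k + 1 - (l : ℝ)) / 2) (by linarith)
    have := hG.comp (0 : ℝ) hin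
    rwa [harg, mul_comm] at this
  have hmain := ((((hlin.mul_const (n : ℝ)).div_const 2).mul_const (log 2)).add_const
    ((n : ℝ) * ((n : ℝ) - 1) / 4 * log π)).add hsum |>.sub
      ((hlin.div_const 2).mul (hasDerivAt_log_det_add_smul (S := S) hS'))
  simp only [zero_mul, zero_smul, add_zero] at hmain
  refine hmain.congr_of_eventuallyEq ?_
  filter_upwards [hν_ev, eventually_posDef_add_smul hS' hS] with t ht hpd
  exact log_invWishartMass ht hpd

/-- The inverse Wishart distribution, in the coordinates of `lowerToSym`. -/
noncomputable def invWishartMeasure (n : ℕ) (ν : ℝ) (S : Matrix (Fin n) (Fin n) ℝ) :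
    Measure (LowerIndex n → ℝ) :=
  (volume.restrict {w | (lowerToSym w).PosDef}).withDensity fun w =>
    ENNReal.ofReal (invWishartDensity n ν S (lowerToSym w))

lemma measurable_invWishartDensity (hS : S.PosDef) :
    Measurable fun w : LowerIndex n → ℝ => invWishartDensity n ν S (lowerToSym w) := by
  simp_rw [invWishartDensity_eq_kernel hS]
  exact (measurable_invWishartKernel ν S).const_mul _

lemma invWishartDensity_pos (hν : (n : ℝ) - 1 < ν) (hS : S.PosDef)
    {D : Matrix (Fin n) (Fin n) ℝ} (hD : D.PosDef) : 0 < invWishartDensity n ν S D := by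
  rw [invWishartDensity_eq_kernel hS]
  exact mul_pos (inv_pos.2 (invWishartMass_pos hν hS)) (invWishartKernel_pos ν S hD)

lemma integral_invWishartMeasure (hν : (n : ℝ) - 1 < ν) (hS : S.PosDef)
    (f : (LowerIndex n → ℝ) → ℝ) :
    ∫ w, f w ∂invWishartMeasure n ν S =
      ∫ w in {w | (lowerToSym w).PosDef}, invWishartDensity n ν S (lowerToSym w) * f w := by
  rw [invWishartMeasure, integral_withDensity_eq_integral_toReal_smul
    (measurable_invWishartDensity hS).ennreal_ofReal (by simp)]
  refine setIntegral_congr_fun measurableSet_posDef_lowerToSym fun w hw => ?_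
  simp only [smul_eq_mul]
  rw [ENNReal.toReal_ofReal (invWishartDensity_pos hν hS hw).le]

lemma integrable_invWishartMeasure_iff (hν : (n : ℝ) - 1 < ν) (hS : S.PosDef)
    (f : (LowerIndex n → ℝ) → ℝ) :
    Integrable f (invWishartMeasure n ν S) ↔
      IntegrableOn (fun w => invWishartDensity n ν S (lowerToSym w) * f w)
        {w | (lowerToSym w).PosDef} := by
  rw [invWishartMeasure, integrable_withDensity_iff_integrable_smul'
    (measurable_invWishartDensity hS).ennreal_ofReal (by simp)]
  refine integrableOn_congr_fun (fun w hw => ?_) measurableSet_posDef_lowerToSym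
  simp only [smul_eq_mul]
  rw [ENNReal.toReal_ofReal (invWishartDensity_pos hν hS hw).le]

lemma invWishartDensity_mul_exp_log_density (hν : (n : ℝ) - 1 < ν) (hS : S.PosDef)
    (hS' : S'.PosDef) (t : ℝ) {D : Matrix (Fin n) (Fin n) ℝ} (hD : D.PosDef) :
    invWishartDensity n ν' S' D * exp (t * log (invWishartDensity n ν S D)) =
      ((invWishartMass n ν' S')⁻¹ * exp (-(t * log (invWishartMass n ν S)))) *
        invWishartKernel n (ν' + t * (ν + n + 1)) (S' + t • S) D := by
  rw [invWishartDensity_eq_kernel hS', mul_assoc, mul_assoc,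
    invWishartKernel_mul_exp_log_density hν hS t hD]

lemma integrable_exp_mul_log_invWishartDensity (hν : (n : ℝ) - 1 < ν) (hν' : (n : ℝ) - 1 < ν')
    (hS : S.PosDef) (hS' : S'.PosDef) {t : ℝ} (ht : (n : ℝ) - 1 < ν' + t * (ν + n + 1))
    (hpd : (S' + t • S).PosDef) :
    Integrable (fun w => exp (t * log (invWishartDensity n ν S (lowerToSym w))))
      (invWishartMeasure n ν' S') := by
  rw [integrable_invWishartMeasure_iff hν' hS']
  exact IntegrableOn.congr_fun ((integrable_invWishartKernel ht hpd).const_mul _)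
    (fun w hw => (invWishartDensity_mul_exp_log_density hν hS hS' t hw).symm)
    measurableSet_posDef_lowerToSym

lemma mgf_log_invWishartDensity (hν : (n : ℝ) - 1 < ν) (hν' : (n : ℝ) - 1 < ν')
    (hS : S.PosDef) (hS' : S'.PosDef) {t : ℝ} (ht : (n : ℝ) - 1 < ν' + t * (ν + n + 1))
    (hpd : (S' + t • S).PosDef) :
    mgf (fun w => log (invWishartDensity n ν S (lowerToSym w))) (invWishartMeasure n ν' S') t =
      exp (log (invWishartMass n (ν' + t * (ν + n + 1)) (S' + t • S)) -
        t * log (invWishartMass n ν S) - log (invWishartMass n ν' S')) := by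
  rw [mgf, integral_invWishartMeasure hν' hS', setIntegral_congr_fun
    measurableSet_posDef_lowerToSym
    (fun w hw => invWishartDensity_mul_exp_log_density hν hS hS' t hw), integral_const_mul,
    integral_invWishartKernel ht hpd, exp_sub, sub_eq_add_neg, exp_add,
    exp_log (invWishartMass_pos ht hpd), exp_log (invWishartMass_pos hν' hS')]
  ring

lemma integral_log_invWishartDensity (hν : (n : ℝ) - 1 < ν) (hν' : (n : ℝ) - 1 < ν')
    (hS : S.PosDef) (hS' : S'.PosDef) :
    ∫ w, log (invWishartDensity n ν S (lowerToSym w)) ∂invWishartMeasure n ν' S' =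
      (ν + n + 1) * n / 2 * log 2 +
        ∑ l ∈ Finset.Icc 1 n, (ν + n + 1) / 2 * digamma ((ν' - (l : ℝ) + 1) / 2) -
        ((ν + n + 1) / 2 * log S'.det + ν' / 2 * (S'⁻¹ * S).trace) -
        log (invWishartMass n ν S) := by
  set X : (LowerIndex n → ℝ) → ℝ := fun w => log (invWishartDensity n ν S (lowerToSym w)) with hX
  have hν_ev : ∀ᶠ t : ℝ in 𝓝 0, (n : ℝ) - 1 < ν' + t * (ν + n + 1) :=
    (by fun_prop : Continuous fun t : ℝ => ν' + t * (ν + n + 1)).continuousAt.eventually_const_lt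
      (by simpa using hν')
  have hpd_ev := eventually_posDef_add_smul hS' hS.isHermitian
  have hmem : (0 : ℝ) ∈ interior (integrableExpSet X (invWishartMeasure n ν' S')) := by
    rw [mem_interior_iff_mem_nhds]
    filter_upwards [hν_ev, hpd_ev] with t ht hpd
    exact integrable_exp_mul_log_invWishartDensity hν hν' hS hS' ht hpd
  have hmgf := hasDerivAt_mgf hmem
  have hexp := (((hasDerivAt_log_invWishartMass hν' hS' hS.isHermitian (ν + n + 1)).sub
    ((hasDerivAt_id (0 : ℝ)).mul_const (log (invWishartMass n ν S)))).sub_const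
    (log (invWishartMass n ν' S'))).exp
  have heq : mgf X (invWishartMeasure n ν' S') =ᶠ[𝓝 0] fun t =>
      exp (log (invWishartMass n (ν' + t * (ν + n + 1)) (S' + t • S)) -
        t * log (invWishartMass n ν S) - log (invWishartMass n ν' S')) := by
    filter_upwards [hν_ev, hpd_ev] with t ht hpd
    exact mgf_log_invWishartDensity hν hν' hS hS' ht hpd
  have huniq := hmgf.unique (hexp.congr_of_eventuallyEq heq)
  simpa using huniq

end CrossEntropy

/-- **Inverse Wishart cross-entropy:**
`∫ p_IW(D; ν′, S′) log p_IW(D; ν, S) dD` over the cone of symmetric positive definite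
matrices equals
`-(ν′/2) tr(S′⁻¹S) - (r(r-1)/4) log π - ∑_l log Γ((ν+1-l)/2) + (ν/2) log det S
 - ((ν+r+1)/2)[log det S′ - ∑_l ψ((ν′-l+1)/2) - r log 2] - (νr/2) log 2`. -/
theorem invWishart_cross_entropy {r : ℕ} (hr : 1 ≤ r)
    (ν ν' : ℝ) (hν : (r : ℝ) - 1 < ν) (hν' : (r : ℝ) - 1 < ν')
    (S S' : Matrix (Fin r) (Fin r) ℝ) (hS : S.PosDef) (hS' : S'.PosDef) :
    spdIntegral r (fun D =>
        invWishartDensity r ν' S' D * Real.log (invWishartDensity r ν S D)) =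
      -(ν' / 2) * (S'⁻¹ * S).trace
        - ((r : ℝ) * ((r : ℝ) - 1) / 4) * Real.log Real.pi
        - (∑ l ∈ Finset.Icc 1 r, Real.log (Real.Gamma ((ν + 1 - (l : ℝ)) / 2)))
        + (ν / 2) * Real.log S.det
        - ((ν + (r : ℝ) + 1) / 2) *
            (Real.log S'.det - (∑ l ∈ Finset.Icc 1 r, digamma ((ν' - (l : ℝ) + 1) / 2))
              - (r : ℝ) * Real.log 2)
        - (ν * (r : ℝ) / 2) * Real.log 2 := by
  have h := integral_log_invWishartDensity hν hν' hS hS'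
  rw [integral_invWishartMeasure hν' hS', log_invWishartMass hν hS, ← Finset.mul_sum] at h
  rw [spdIntegral, integral_indicator measurableSet_posDef_lowerToSym, h]
  ring
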